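/- Let m, n ≥ 1 be integers and let A be the presented group with generators a, b, c and relations ⟨a,c⟩_{2m+1} = ⟨c,a⟩_{2m+1} and ⟨b,c⟩_{2n+1} = ⟨c,b⟩_{2n+1} (no relation between a and b). Then there is no group homomorphism ρ : A → A with ρ(a) = a, ρ(b) = b, and ρ(c) lying in the subgroup generated by a and b; that is, A admits no retraction onto the standard parabolic subgroup generated by a and b. -/

import Mathlib

/-- `altProd u v m` is the alternating product `u * v * u * v * ⋯` with `m` factors. -/
def altProd {G : Type*} [Monoid G] : G → G → ℕ → G
  | _, _, 0 => 1
  | u, v, n + 1 => u * altProd v u n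

/-- Relations of the Artin group of the triangle `(∞, 2m+1, 2n+1)` on generators
`a = 0`, `b = 1`, `c = 2`: `⟨a,c⟩_{2m+1} = ⟨c,a⟩_{2m+1}` and
`⟨b,c⟩_{2n+1} = ⟨c,b⟩_{2n+1}`, and no relation between `a` and `b`. -/
def triangleRels (m n : ℕ) : Set (FreeGroup (Fin 3)) :=
  { altProd (FreeGroup.of 0) (FreeGroup.of 2) (2 * m + 1) *
      (altProd (FreeGroup.of 2) (FreeGroup.of 0) (2 * m + 1))⁻¹,
    altProd (FreeGroup.of 1) (FreeGroup.of 2) (2 * n + 1) *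
      (altProd (FreeGroup.of 2) (FreeGroup.of 1) (2 * n + 1))⁻¹ }

open scoped Quaternion

theorem altProd_odd {G : Type*} [Monoid G] (u v : G) (k : ℕ) :
    altProd u v (2 * k + 1) = (u * v) ^ k * u := by
  induction k with
  | zero => simp [altProd]
  | succ k ih =>
    change u * (v * altProd u v (2 * k + 1)) = _
    rw [ih, pow_succ']
    simp only [mul_assoc]

theorem map_altProd {G H : Type*} [Monoid G] [Monoid H] (f : G →* H) (u v : G) (k : ℕ) :
    f (altProd u v k) = altProd (f u) (f v) k := by
  induction k generalizing u v with
  | zero => simp [altProd]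
  | succ k ih => simp [altProd, ih]

theorem sin_smul_pow_succ {R : Type*} [Ring R] [Algebra ℂ R] (φ : ℂ) {q : R}
    (hq : q * q = (2 * Complex.cos φ) • q - 1) (k : ℕ) :
    Complex.sin φ • q ^ (k + 1) =
      Complex.sin ((k + 1) * φ) • q - Complex.sin (k * φ) • (1 : R) := by
  induction k with
  | zero => simp
  | succ k ih =>
    have hsin : Complex.sin ((k + 1 + 1) * φ) =
        2 * Complex.cos φ * Complex.sin ((k + 1) * φ) - Complex.sin (k * φ) := by
      have h₁ : (k + 1 + 1) * φ = (k + 1) * φ + φ := by ring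
      have h₂ : k * φ = (k + 1) * φ - φ := by ring
      rw [h₁, h₂, Complex.sin_add, Complex.sin_sub]
      ring
    rw [pow_succ, ← smul_mul_assoc, ih, sub_mul, smul_mul_assoc, smul_mul_assoc, hq, one_mul]
    push_cast
    rw [hsin]
    module

/-- Two square roots of `-1` meeting at the angle prescribed by an odd label satisfy the
corresponding braid relation. -/
theorem altProd_comm_of_sq_eq_neg_one {R : Type*} [Ring R] [Algebra ℂ R] {k : ℕ} (hk : 1 ≤ k)
    {u v : R} (hu : u * u = -1) (hv : v * v = -1)
    (huv : u * v + v * u = (2 * Complex.cos (Real.pi / (2 * k + 1) : ℝ)) • (1 : R)) :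
    altProd u v (2 * k + 1) = altProd v u (2 * k + 1) := by
  set θ : ℝ := Real.pi / (2 * k + 1) with hθ
  have hk' : (1 : ℝ) ≤ k := by exact_mod_cast hk
  have hsin : Complex.sin (θ : ℂ) ≠ 0 := by
    rw [← Complex.ofReal_sin]
    have hpos : 0 < θ := by positivity
    have hlt : θ < Real.pi := div_lt_self Real.pi_pos (by linarith)
    exact_mod_cast (Real.sin_pos_of_pos_of_lt_pi hpos hlt).ne'
  have hmul : (2 * k + 1 : ℂ) * θ = Real.pi := by
    have : (2 * k + 1 : ℝ) * θ = Real.pi := by rw [hθ]; field_simp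
    exact_mod_cast this
  have hsq : (u * v) * (u * v) = (2 * Complex.cos (θ : ℂ)) • (u * v) - 1 := by
    have hvu : v * u = (2 * Complex.cos (θ : ℂ)) • (1 : R) - u * v := eq_sub_of_add_eq' huv
    calc (u * v) * (u * v) = u * (v * u) * v := by noncomm_ring
      _ = (2 * Complex.cos (θ : ℂ)) • (u * v) - (u * u) * (v * v) := by
        rw [hvu, mul_sub, sub_mul, mul_smul_comm, smul_mul_assoc, mul_one]
        noncomm_ring
      _ = _ := by simp [hu, hv]
  have hpow : (u * v) ^ (2 * k + 1) = -1 := by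
    have h := sin_smul_pow_succ (θ : ℂ) hsq (2 * k)
    have h₂ : (2 * k : ℂ) * θ = Real.pi - θ := by rw [← hmul]; ring
    push_cast at h
    rw [hmul, h₂, Complex.sin_pi, Complex.sin_pi_sub, zero_smul, zero_sub, ← smul_neg] at h
    exact smul_right_injective R hsin h
  have hinv : (u * v) * (v * u) = 1 := by
    calc (u * v) * (v * u) = u * (v * v) * u := by noncomm_ring
      _ = 1 := by simp [hu, hv]
  have hinv' : (v * u) * (u * v) = 1 := by
    calc (v * u) * (u * v) = v * (u * u) * v := by noncomm_ring
      _ = 1 := by simp [hu, hv]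
  have hpowinv : (u * v) ^ k * (v * u) ^ k = 1 := by
    have hc : Commute (u * v) (v * u) := hinv.trans hinv'.symm
    rw [← hc.mul_pow, hinv, one_pow]
  have hneg : (u * v) ^ (k + 1) = -(v * u) ^ k := by
    calc (u * v) ^ (k + 1) = (u * v) ^ (2 * k + 1) * (v * u) ^ k := by
          rw [show 2 * k + 1 = k + 1 + k by ring, pow_add _ (k + 1), mul_assoc, hpowinv, mul_one]
      _ = _ := by rw [hpow, neg_one_mul]
  rw [altProd_odd, altProd_odd]
  have hswap : (v * u) ^ k * v = v * (u * v) ^ k := mul_pow_mul v u k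
  have hswap' : (u * v) ^ k * u = u * (v * u) ^ k := mul_pow_mul u v k
  rw [hswap, hswap', ← neg_neg ((v * u) ^ k), ← hneg, pow_succ']
  calc u * -(u * v * (u * v) ^ k) = -(u * u) * (v * (u * v) ^ k) := by noncomm_ring
    _ = _ := by simp [hu]

/-- The elements commuting with `u` up to sign. -/
def signCentralizer {G : Type*} [Group G] [HasDistribNeg G] (u : G) : Subgroup G where
  carrier := {h | h * u = u * h ∨ h * u = -(u * h)}
  one_mem' := by simp
  mul_mem' := by
    rintro x y (hx | hx) (hy | hy) <;>
      simp [mul_assoc, hy, ← mul_assoc x u y, hx]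
  inv_mem' := by
    rintro x (hx | hx)
    · left
      rw [inv_mul_eq_iff_eq_mul, ← mul_assoc, hx, mul_inv_cancel_right]
    · right
      rw [inv_mul_eq_iff_eq_mul, mul_neg, ← mul_assoc, hx, neg_mul, neg_neg, mul_inv_cancel_right]

theorem eq_or_eq_neg_of_altProd_comm {G : Type*} [Group G] [HasDistribNeg G] {u w : G} {k : ℕ}
    (hw : w ∈ signCentralizer u) (h : altProd u w (2 * k + 1) = altProd w u (2 * k + 1)) :
    w = u ∨ w = -u := by
  have hu : u ∈ signCentralizer u := Or.inl rfl
  rw [altProd_odd, altProd_odd, mul_pow_mul w u k] at h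
  rcases (pow_mem (mul_mem hu hw) k : (u * w) ^ k ∈ signCentralizer u) with h' | h'
  · exact Or.inl (mul_right_cancel (h.symm.trans h'))
  · rw [← neg_mul] at h'
    exact Or.inr (mul_right_cancel (h.symm.trans h'))

/-- An element of the subgroup generated by two anticommuting elements cannot satisfy odd braid
relations with both of them. -/
theorem altProd_ne_of_mem_closure {G : Type*} [Group G] [HasDistribNeg G] (hneg : (-1 : G) ≠ 1)
    {u v w : G} (huv : u * v = -(v * u)) (hw : w ∈ Subgroup.closure {u, v}) {k l : ℕ}
    (hu : altProd u w (2 * k + 1) = altProd w u (2 * k + 1)) :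
    altProd v w (2 * l + 1) ≠ altProd w v (2 * l + 1) := by
  intro hv
  have hvu : v * u = -(u * v) := by rw [huv, neg_neg]
  have hwu : w ∈ signCentralizer u := by
    refine (Subgroup.closure_le _).2 ?_ hw
    rintro _ (rfl | rfl)
    exacts [Or.inl rfl, Or.inr hvu]
  have hwv : w ∈ signCentralizer v := by
    refine (Subgroup.closure_le _).2 ?_ hw
    rintro _ (rfl | rfl)
    exacts [Or.inr huv, Or.inl rfl]
  have heq : u = v ∨ u = -v := by
    rcases eq_or_eq_neg_of_altProd_comm hwu hu with rfl | rfl <;>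
      rcases eq_or_eq_neg_of_altProd_comm hwv hv with h | h
    exacts [Or.inl h, Or.inr h, Or.inr (neg_eq_iff_eq_neg.1 h), Or.inl (neg_injective h)]
  have hcomm : u * v = v * u := by
    rcases heq with rfl | rfl <;> simp
  refine hneg (mul_right_cancel (b := v * u) ?_)
  rw [neg_one_mul, one_mul, ← huv, hcomm]

theorem of_altProd_comm_left (m n : ℕ) :
    altProd (PresentedGroup.of 0 : PresentedGroup (triangleRels m n)) (PresentedGroup.of 2)
        (2 * m + 1) =
      altProd (PresentedGroup.of 2) (PresentedGroup.of 0) (2 * m + 1) := by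
  have h := PresentedGroup.one_of_mem (rels := triangleRels m n) (Or.inl rfl)
  rw [map_mul, map_inv, mul_inv_eq_one, map_altProd, map_altProd] at h
  exact h

theorem of_altProd_comm_right (m n : ℕ) :
    altProd (PresentedGroup.of 1 : PresentedGroup (triangleRels m n)) (PresentedGroup.of 2)
        (2 * n + 1) =
      altProd (PresentedGroup.of 2) (PresentedGroup.of 1) (2 * n + 1) := by
  have h := PresentedGroup.one_of_mem (rels := triangleRels m n) (Or.inr rfl)
  rw [map_mul, map_inv, mul_inv_eq_one, map_altProd, map_altProd] at h
  exact h

/-- A square root of `-1` as a unit. -/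
def unitOfSqEqNegOne {R : Type*} [Ring R] (x : R) (hx : x * x = -1) : Rˣ where
  val := x
  inv := -x
  val_inv := by simp [hx]
  inv_val := by simp [hx]

/-- The Artin group maps to the units of the complex quaternions with `a ↦ i` and `b ↦ j`; in
particular the images of `a` and `b` anticommute. -/
theorem exists_hom_quaternion_units {m n : ℕ} (hm : 1 ≤ m) (hn : 1 ≤ n) :
    ∃ ψ : PresentedGroup (triangleRels m n) →* ℍ[ℂ]ˣ,
      ψ (PresentedGroup.of 0) * ψ (PresentedGroup.of 1) =
        -(ψ (PresentedGroup.of 1) * ψ (PresentedGroup.of 0)) := by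
  set x : ℂ := -Complex.cos (Real.pi / (2 * m + 1) : ℝ) with hx
  set y : ℂ := -Complex.cos (Real.pi / (2 * n + 1) : ℝ) with hy
  obtain ⟨z, hz⟩ := IsAlgClosed.exists_pow_nat_eq (1 - x ^ 2 - y ^ 2) (n := 2) two_pos
  have ha : (⟨0, 1, 0, 0⟩ : ℍ[ℂ]) * ⟨0, 1, 0, 0⟩ = -1 := by ext <;> simp
  have hb : (⟨0, 0, 1, 0⟩ : ℍ[ℂ]) * ⟨0, 0, 1, 0⟩ = -1 := by ext <;> simp
  have hc : (⟨0, x, y, z⟩ : ℍ[ℂ]) * ⟨0, x, y, z⟩ = -1 := by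
    ext <;> simp <;> first | ring1 | linear_combination -hz
  have hab : (⟨0, 1, 0, 0⟩ : ℍ[ℂ]) * ⟨0, 0, 1, 0⟩ = -(⟨0, 0, 1, 0⟩ * ⟨0, 1, 0, 0⟩) := by
    ext <;> simp
  have hac := altProd_comm_of_sq_eq_neg_one hm ha hc (by ext <;> simp [hx]; ring)
  have hbc := altProd_comm_of_sq_eq_neg_one hn hb hc (by ext <;> simp [hy]; ring)
  let f : Fin 3 → ℍ[ℂ]ˣ :=
    ![unitOfSqEqNegOne _ ha, unitOfSqEqNegOne _ hb, unitOfSqEqNegOne _ hc]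
  have hf : ∀ r ∈ triangleRels m n, FreeGroup.lift f r = 1 := by
    rintro r (rfl | rfl)
    all_goals
      rw [map_mul, map_inv, mul_inv_eq_one, map_altProd, map_altProd]
      apply Units.ext
      simp only [FreeGroup.lift_apply_of, ← Units.coeHom_apply, map_altProd]
      assumption
  refine ⟨PresentedGroup.toGroup hf, ?_⟩
  rw [PresentedGroup.toGroup.of, PresentedGroup.toGroup.of]
  exact Units.ext hab

/-- The Artin group of the triangle `(∞, 2m+1, 2n+1)` admits no retraction onto the
standard parabolic subgroup generated by `a` and `b`. -/
theorem no_retraction_inf_odd_odd (m n : ℕ) (hm : 1 ≤ m) (hn : 1 ≤ n) :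
    ¬ ∃ ρ : PresentedGroup (triangleRels m n) →* PresentedGroup (triangleRels m n),
        ρ (PresentedGroup.of 0) = PresentedGroup.of 0 ∧
        ρ (PresentedGroup.of 1) = PresentedGroup.of 1 ∧
        ρ (PresentedGroup.of 2) ∈
          Subgroup.closure {PresentedGroup.of 0, PresentedGroup.of 1} := by
  rintro ⟨ρ, h0, h1, h2⟩
  obtain ⟨ψ, hψ⟩ := exists_hom_quaternion_units hm hn
  have hw := Subgroup.mem_map_of_mem ψ h2
  rw [MonoidHom.map_closure, Set.image_pair] at hw
  have ha := congrArg (ψ.comp ρ) (of_altProd_comm_left m n)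
  have hb := congrArg (ψ.comp ρ) (of_altProd_comm_right m n)
  simp only [map_altProd, MonoidHom.comp_apply, h0, h1] at ha hb
  have hneg : (-1 : ℍ[ℂ]ˣ) ≠ 1 := by
    intro h
    have hval : (-1 : ℍ[ℂ]) = 1 := congrArg Units.val h
    exact two_ne_zero (α := ℂ) (by
      simpa [neg_eq_iff_add_eq_zero, one_add_one_eq_two] using
        congrArg QuaternionAlgebra.re hval)
  exact altProd_ne_of_mem_closure hneg hψ hw ha hb
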